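/- arXiv:1706.09136 — 2 statements merged into one kernel-verified Lean document; each statement's English description precedes it below -/
import Mathlib

section
/- For every prime p > 5, the polynomial identity £^{OY}_{(1,1,1,1)}(t) = £^{OY}_{(1,1,1,1)}(1-t) holds in (ZMod p)[t]. -/
open Polynomial Finset

/-- £^OY_{(1,1,1,1)} with tˢ replaced by uˢ. -/
noncomputable def OY1111 (p : ℕ) (u : Polynomial (ZMod p)) : Polynomial (ZMod p) :=
  ∑ l1 ∈ Ico 1 p, ∑ l2 ∈ Ico 1 p, ∑ l3 ∈ Ico 1 p, ∑ l4 ∈ Ico 1 p,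
    if ¬ p ∣ l1 ∧ ¬ p ∣ (l1 + l2) ∧ ¬ p ∣ (l1 + l2 + l3) ∧ ¬ p ∣ (l1 + l2 + l3 + l4) then
      C ((l1 : ZMod p)⁻¹ * ((l1 + l2 : ℕ) : ZMod p)⁻¹ * ((l1 + l2 + l3 : ℕ) : ZMod p)⁻¹
          * ((l1 + l2 + l3 + l4 : ℕ) : ZMod p)⁻¹) * u ^ (l1 + l2 + l3 + l4)
    else 0

namespace OYaux
variable {p : ℕ} [Fact p.Prime]

noncomputable def W (p : ℕ) : (ZMod p)[X] := ∑ l ∈ Ico 1 p, X ^ l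
noncomputable def f1 (p : ℕ) : (ZMod p)[X] := ∑ l ∈ Ico 1 p, C ((l : ZMod p)⁻¹) * X ^ l
noncomputable def I (p : ℕ) : (ZMod p)[X] →ₗ[ZMod p] (ZMod p)[X] :=
  Polynomial.lsum (fun n => (monomial n) ∘ₗ (LinearMap.mulLeft (ZMod p) ((n : ZMod p)⁻¹)))

lemma I_mon (a : ZMod p) (n : ℕ) : I p (C a * X ^ n) = C (a * (n : ZMod p)⁻¹) * X ^ n := by
  rw [C_mul_X_pow_eq_monomial, C_mul_X_pow_eq_monomial]
  simp [I, Polynomial.lsum, Polynomial.sum_monomial_index, mul_comm]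

lemma I_coeff (h : (ZMod p)[X]) (n : ℕ) : (I p h).coeff n = (n : ZMod p)⁻¹ * h.coeff n := by
  induction h using Polynomial.induction_on' with
  | add f g hf hg => simp [hf, hg, mul_add]
  | monomial m a =>
    rw [← C_mul_X_pow_eq_monomial, I_mon]
    simp only [coeff_C_mul, coeff_X_pow]
    split_ifs with h <;> simp [h, mul_comm]

lemma W_mul_mon (a : ZMod p) (n : ℕ) : W p * (C a * X ^ n) = ∑ l ∈ Ico 1 p, C a * X ^ (n + l) := by
  rw [W, sum_mul]; refine sum_congr rfl fun l _ => ?_; ring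

lemma cast_ne {n : ℕ} (h : 1 ≤ n) (h' : n < p) : (n : ZMod p) ≠ 0 := by
  rw [Ne, ZMod.natCast_eq_zero_iff]
  exact Nat.not_dvd_of_pos_of_lt h h'

lemma coeff_theta (G : (ZMod p)[X]) (n : ℕ) : (X * derivative G).coeff n = n * G.coeff n := by
  cases n with
  | zero => simp
  | succ n => rw [coeff_X_mul, coeff_derivative]; push_cast; ring

lemma I_theta (G h : (ZMod p)[X]) (hG : X * derivative G = h) :
    I p h = G - expand (ZMod p) p (contract p G) := by
  have hp : p ≠ 0 := (Fact.out : p.Prime).ne_zero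
  ext n
  rw [I_coeff, ← hG, coeff_theta, coeff_sub, coeff_expand (Nat.pos_of_ne_zero hp)]
  split_ifs with h
  · obtain ⟨k, rfl⟩ := h
    rw [Nat.mul_div_cancel_left k (Nat.pos_of_ne_zero hp), coeff_contract hp]
    simp [mul_comm p k]
  · have : (n : ZMod p) ≠ 0 := by rwa [Ne, ZMod.natCast_eq_zero_iff]
    field_simp; simp

lemma theta_f1 : X * derivative (f1 p) = W p := by
  simp only [f1, W, derivative_sum, mul_sum]
  refine sum_congr rfl fun l hl => ?_
  rw [mem_Ico] at hl
  have := cast_ne hl.1 hl.2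
  ext n
  rw [coeff_theta, coeff_C_mul, coeff_X_pow]
  split_ifs with h
  · subst h; simp [this]
  · simp

lemma f1_coeff (n : ℕ) : (f1 p).coeff n = if n < p then (n : ZMod p)⁻¹ else 0 := by
  simp only [f1, finsetSum_coeff, coeff_C_mul, coeff_X_pow, mul_ite, mul_one, mul_zero,
    sum_ite_eq, mem_Ico]
  rcases Nat.eq_zero_or_pos n with rfl | h
  · simp
  · simp [Nat.one_le_iff_ne_zero, h.ne']

lemma W_coeff (n : ℕ) : (W p).coeff n = if 1 ≤ n ∧ n < p then 1 else 0 := by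
  simp only [W, finsetSum_coeff, coeff_X_pow, sum_ite_eq, mem_Ico]

lemma I_W : I p (W p) = f1 p := by
  ext n
  rw [I_coeff, W_coeff, f1_coeff]
  rcases Nat.eq_zero_or_pos n with rfl | h
  · simp
  · by_cases h' : n < p <;> simp [h', Nat.one_le_iff_ne_zero, h.ne']

lemma f1_natDegree : (f1 p).natDegree ≤ p - 1 := by
  rw [natDegree_le_iff_coeff_eq_zero]
  intro N hN
  rw [f1_coeff, if_neg (by omega)]

/-- sum of coefficients in positions divisible by p -/
lemma contract_add' (f g : (ZMod p)[X]) : contract p (f + g) = contract p f + contract p g := by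
  have hp : p ≠ 0 := (Fact.out : p.Prime).ne_zero
  ext n; simp [coeff_contract hp]

lemma contract_smul' (a : ZMod p) (g : (ZMod p)[X]) : contract p (C a * g) = C a * contract p g := by
  have hp : p ≠ 0 := (Fact.out : p.Prime).ne_zero
  ext n; simp [coeff_contract hp]

noncomputable def ct (p : ℕ) [Fact p.Prime] : (ZMod p)[X] →ₗ[ZMod p] (ZMod p)[X] where
  toFun := contract p
  map_add' := contract_add'
  map_smul' a g := by
    rw [smul_eq_C_mul, contract_smul', RingHom.id_apply, smul_eq_C_mul]

lemma eval_ct_mon (n : ℕ) : eval 1 (ct p (X ^ n)) = if p ∣ n then 1 else 0 := by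
  have hp : p ≠ 0 := (Fact.out : p.Prime).ne_zero
  have : contract p (X ^ n : (ZMod p)[X]) = if p ∣ n then X ^ (n / p) else 0 := by
    ext k
    rw [coeff_contract hp, coeff_X_pow]
    split_ifs with h1 h2 h2
    · subst h1; simp [Nat.mul_div_cancel _ (Nat.pos_of_ne_zero hp)]
    · exact absurd ⟨k, by rw [← h1, mul_comm]⟩ h2
    · rw [coeff_X_pow, if_neg]
      rintro rfl
      exact h1 (Nat.div_mul_cancel h2)
    · simp
  change eval 1 (contract p (X ^ n : (ZMod p)[X])) = _
  rw [this]; split_ifs <;> simp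

lemma unique_l (n : ℕ) : ∑ l ∈ range p, (if p ∣ n + l then (1 : ZMod p) else 0) = 1 := by
  have hp : 0 < p := (Fact.out : p.Prime).pos
  have key : ∀ l ∈ range p, (p ∣ n + l ↔ (-(n : ZMod p)).val = l) := by
    intro l hl
    rw [mem_range] at hl
    rw [← ZMod.natCast_eq_zero_iff]
    push_cast
    constructor
    · intro h
      have : (-(n : ZMod p)) = (l : ZMod p) := by linear_combination -h
      rw [this, ZMod.val_natCast_of_lt hl]
    · intro h
      have : ((-(n : ZMod p)).val : ZMod p) = l := by rw [h]
      rw [ZMod.natCast_zmod_val] at this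
      linear_combination -this
  rw [sum_congr rfl fun l hl => by rw [if_congr (key l hl) rfl rfl]]
  rw [sum_ite_eq, if_pos (mem_range.2 (ZMod.val_lt _))]

lemma eval_ct (g : (ZMod p)[X]) : eval 1 (ct p (W p * g)) + eval 1 (ct p g) = eval 1 g := by
  have hp : 0 < p := (Fact.out : p.Prime).pos
  induction g using Polynomial.induction_on' with
  | add f g hf hg => rw [mul_add, map_add, map_add, eval_add, eval_add, eval_add, ← hf, ← hg]; ring
  | monomial m a =>
    rw [← C_mul_X_pow_eq_monomial]
    have h1 : W p * (C a * X ^ m) + C a * X ^ m = ∑ l ∈ range p, a • X ^ (m + l) := by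
      rw [W_mul_mon, range_eq_Ico, sum_eq_sum_Ico_succ_bot hp, add_comm]
      simp [smul_eq_C_mul]
    rw [← eval_add, ← map_add, h1, map_sum, eval_finsetSum]
    simp only [map_smul, eval_smul, eval_ct_mon, smul_eq_mul, ← mul_sum, unique_l]
    simp

lemma eval_ct_pow (k : ℕ) (hk : ((k + 1 : ℕ) : ZMod p) ≠ 0) (hf : eval 1 (f1 p) = 0) (hk0 : k ≠ 0) :
    eval 1 (contract p (f1 p ^ k)) = 0 := by
  have hp : p ≠ 0 := (Fact.out : p.Prime).ne_zero
  have h := eval_ct (f1 p ^ k)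
  rw [eval_pow, hf, zero_pow hk0] at h
  have h2 : ct p (W p * f1 p ^ k) = 0 := by
    change contract p _ = 0
    have h3 : C ((k + 1 : ℕ) : ZMod p) * (W p * f1 p ^ k) = X * derivative (f1 p ^ (k + 1)) := by
      rw [derivative_pow, ← theta_f1]; simp; ring
    ext n
    rw [coeff_contract hp]
    have := congrArg (fun q => coeff q (n * p)) h3
    simp only [coeff_theta, coeff_C_mul] at this
    rw [CharP.cast_eq_zero_iff _ p (n * p) |>.2 (Dvd.intro_left n rfl), zero_mul] at this
    simpa using (mul_eq_zero.1 this).resolve_left hk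
  rw [h2, eval_zero, zero_add] at h
  exact h

/-- binomial transform -/
def D (p : ℕ) (a : ℕ → ZMod p) (n : ℕ) : ZMod p :=
  ∑ k ∈ range p, (-1) ^ k * (n.choose k : ZMod p) * a k

lemma D_R1 (x : ℕ → ZMod p) (hx : x 0 = 0) (n : ℕ) (hn : n < p) :
    D p (fun k => ∑ j ∈ range (k + 1), x j * (j : ZMod p)⁻¹) n = (n : ZMod p)⁻¹ * D p x n := by
  have hp : 0 < p := (Fact.out : p.Prime).pos
  rcases Nat.eq_zero_or_pos n with rfl | h
  · simp only [D, Nat.cast_zero, inv_zero, zero_mul]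
    refine sum_eq_zero fun k _ => ?_
    cases k with
    | zero => simp
    | succ k => simp
  have hn0 := cast_ne h hn
  rw [eq_inv_mul_iff_mul_eq₀ hn0]
  set a : ℕ → ZMod p := fun k => ∑ j ∈ range (k + 1), x j * (j : ZMod p)⁻¹ with ha
  let g : ℕ → ZMod p := fun k => (-1) ^ k * (k * (n.choose k : ZMod p)) * a (k - 1)
  have h1 : ∑ k ∈ range p, g (k + 1) = ∑ k ∈ range p, g k := by
    have e1 := sum_range_succ g p
    have e2 := sum_range_succ' g p
    have g0 : g 0 = 0 := by simp [g]
    have gp : g p = 0 := by simp [g]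
    rw [e1, g0, gp] at e2
    simpa using e2.symm
  have h2 : ∀ k, (n : ZMod p) * (n.choose k) = k * n.choose k + (k + 1 : ℕ) * n.choose (k + 1) := by
    intro k
    have := Nat.choose_succ_right_eq n k
    rcases le_or_gt k n with hk | hk
    · have h3 : n.choose (k + 1) * (k + 1) + n.choose k * k = n.choose k * n := by
        rw [this, ← mul_add, Nat.sub_add_cancel hk]
      have h4 := congrArg (Nat.cast (R := ZMod p)) h3
      push_cast at h4 ⊢
      linear_combination -h4
    · simp [Nat.choose_eq_zero_of_lt hk, Nat.choose_eq_zero_of_lt (Nat.lt_succ_of_lt hk)]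
  have h3 : (n : ZMod p) * D p a n = ∑ k ∈ range p, ((-1) ^ k * (k * n.choose k) * a k - g (k + 1)) := by
    rw [D, mul_sum]
    refine sum_congr rfl fun k _ => ?_
    simp only [g, Nat.add_sub_cancel]
    rw [pow_succ]
    linear_combination (-1) ^ k * a k * h2 k
  rw [h3, sum_sub_distrib, h1, ← sum_sub_distrib, D]
  refine sum_congr rfl fun k hk => ?_
  rw [mem_range] at hk
  cases k with
  | zero => simp [hx, g]
  | succ k =>
    have hk0 := cast_ne (Nat.succ_pos k) hk
    have : a (k + 1) = a k + x (k + 1) * ((k + 1 : ℕ) : ZMod p)⁻¹ := by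
      simp only [ha]; rw [sum_range_succ _ (k + 1)]
    simp only [g, Nat.add_sub_cancel]
    rw [this]
    field_simp
    ring

lemma D_R2 (a : ℕ → ZMod p) (ha : a 0 = 0) (n : ℕ) (hn : n < p) :
    D p (fun k => a k * (k : ZMod p)⁻¹) n = ∑ j ∈ range (n + 1), (j : ZMod p)⁻¹ * D p a j := by
  have hp : 0 < p := (Fact.out : p.Prime).pos
  induction n with
  | zero =>
    simp only [zero_add, sum_range_one, Nat.cast_zero, inv_zero, zero_mul, D]
    refine sum_eq_zero fun k _ => ?_
    cases k with
    | zero => simp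
    | succ k => simp
  | succ n ih =>
    rw [sum_range_succ, ← ih (by omega), ← sub_eq_iff_eq_add', D, D, D, mul_sum, ← sum_sub_distrib]
    refine sum_congr rfl fun k hk => ?_
    rw [mem_range] at hk
    cases k with
    | zero => simp [ha]
    | succ k =>
      have hk0 := cast_ne (Nat.succ_pos k) hk
      have hn0 := cast_ne (Nat.succ_pos n) hn
      have h := congrArg (Nat.cast (R := ZMod p)) (Nat.add_one_mul_choose_eq n k)
      have h' := congrArg (Nat.cast (R := ZMod p)) (Nat.choose_succ_succ n k)
      simp only [Nat.succ_eq_add_one] at *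
      rw [Nat.cast_mul, Nat.cast_mul] at h
      rw [Nat.cast_add] at h'
      field_simp
      linear_combination a (k+1) * h + a (k+1) * ((n+1 : ℕ) : ZMod p) * h'

lemma D_pred (a : ℕ → ZMod p) : D p a (p - 1) = ∑ k ∈ range p, a k := by
  have hpp : p.Prime := Fact.out
  have key : ∀ k, k < p → ((p - 1).choose k : ZMod p) = (-1) ^ k := by
    intro k
    induction k with
    | zero => simp
    | succ k ih =>
      intro hk
      have h1 : p.choose (k + 1) = (p - 1).choose k + (p - 1).choose (k + 1) := by
        obtain ⟨q, rfl⟩ : ∃ q, p = q + 1 := ⟨p - 1, by omega⟩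
        simp [Nat.choose_succ_succ]
      have h2 : (p.choose (k + 1) : ZMod p) = 0 := by
        rw [ZMod.natCast_eq_zero_iff]
        exact hpp.dvd_choose_self (by omega) hk
      rw [h1, Nat.cast_add, ih (by omega)] at h2
      rw [pow_succ]; linear_combination h2
  refine sum_congr rfl fun k hk => ?_
  rw [key k (mem_range.1 hk), ← mul_pow]; simp

lemma D_one (n : ℕ) (h : 1 ≤ n) (hn : n < p) : D p (fun k => k * (k : ZMod p)⁻¹) n = -1 := by
  have h1 : ∑ k ∈ range p, (-1) ^ k * (n.choose k : ZMod p) = 0 := by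
    have h2 := add_pow (-1 : ZMod p) 1 n
    rw [neg_add_cancel, zero_pow (by omega)] at h2
    rw [h2]
    symm
    refine (sum_subset (range_subset_range.2 (show n + 1 ≤ p by omega)) fun k _ hk => ?_).trans ?_
    · rw [mem_range, not_lt] at hk
      rw [Nat.choose_eq_zero_of_lt (by omega)]; simp
    · exact sum_congr rfl fun k _ => by ring
  have hp : 0 < p := by omega
  obtain ⟨q, rfl⟩ : ∃ q, p = q + 1 := ⟨p - 1, by omega⟩
  rw [sum_range_succ'] at h1
  rw [D, sum_range_succ']
  have : ∀ k ∈ range q, (-1) ^ (k + 1) * (n.choose (k + 1) : ZMod (q + 1)) *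
      (((k + 1 : ℕ) : ZMod (q + 1)) * ((k + 1 : ℕ) : ZMod (q + 1))⁻¹) =
      (-1) ^ (k + 1) * (n.choose (k + 1) : ZMod (q + 1)) := by
    intro k hk
    rw [mem_range] at hk
    rw [mul_inv_cancel₀ (cast_ne (by omega) (by omega)), mul_one]
  rw [sum_congr rfl this]
  simp at h1 ⊢
  linear_combination h1

/-- generic inverse power -/
abbrev iv (p : ℕ) (n : ℕ) : ZMod p := (n : ZMod p)⁻¹

lemma duality : ∑ k ∈ range p, (∑ j ∈ range (k + 1), (∑ i ∈ range (j + 1), iv p i) * iv p j) * iv p k * iv p k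
    = - ∑ k ∈ range p, iv p k * ∑ j ∈ range (k + 1), iv p j ^ 3 := by
  have hp : 0 < p := (Fact.out : p.Prime).pos
  have hH : ∀ n < p, D p (fun k => ∑ i ∈ range (k + 1), iv p i) n = - iv p n := by
    intro n hn
    have h := D_R1 (p := p) (fun k => k * (k : ZMod p)⁻¹) (by simp) n hn
    have e : (fun k => ∑ j ∈ range (k + 1), ((j : ZMod p) * (j : ZMod p)⁻¹) * (j : ZMod p)⁻¹)
        = fun k => ∑ i ∈ range (k + 1), iv p i := by
      funext k; refine sum_congr rfl fun j _ => ?_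
      by_cases hj : (j : ZMod p) = 0
      · simp [hj]
      · field_simp
    rw [e] at h
    rw [h]
    rcases Nat.eq_zero_or_pos n with rfl | h0
    · simp
    · rw [D_one n h0 hn]; simp
  have hS : ∀ n < p, D p (fun k => ∑ j ∈ range (k + 1), (∑ i ∈ range (j + 1), iv p i) * iv p j) n
      = iv p n * - iv p n := by
    intro n hn
    rw [← hH n hn]
    exact D_R1 (p := p) (fun k => ∑ i ∈ range (k + 1), iv p i) (by simp) n hn
  have hS2 : ∀ n < p, D p (fun k => (∑ j ∈ range (k + 1), (∑ i ∈ range (j + 1), iv p i) * iv p j) * iv p k) n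
      = - ∑ j ∈ range (n + 1), iv p j ^ 3 := by
    intro n hn
    rw [D_R2 _ (by simp) n hn, ← sum_neg_distrib]
    refine sum_congr rfl fun j hj => ?_
    rw [mem_range] at hj
    rw [hS j (by omega)]; ring
  rw [← D_pred, D_R2 _ (by simp) _ (by omega), Nat.sub_add_cancel hp, ← sum_neg_distrib]
  refine sum_congr rfl fun j hj => ?_
  rw [hS2 j (mem_range.1 hj)]; ring

lemma sum_iv_pow (s : ℕ) (hs : s ≠ 0) (h : s < p - 1) : ∑ k ∈ range p, iv p k ^ s = 0 := by
  have h1 := FiniteField.sum_pow_lt_card_sub_one (ZMod p) s (by rwa [ZMod.card])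
  have h2 : ∑ x : ZMod p, x ^ s = ∑ x : ZMod p, (x⁻¹) ^ s :=
    (Equiv.sum_comp (Equiv.inv (ZMod p)) (fun x => x ^ s)).symm
  rw [← h1, h2]
  symm
  refine sum_bij' (fun x _ => x.val) (fun k _ => (k : ZMod p)) ?_ ?_ ?_ ?_ ?_
  · intro x _; exact mem_range.2 (ZMod.val_lt x)
  · simp
  · intro x _; simp
  · intro k hk; exact ZMod.val_natCast_of_lt (mem_range.1 hk)
  · intro x _; simp [iv]

lemma sum_split (u v : ℕ → ZMod p) (n : ℕ) : (∑ k ∈ range n, u k) * (∑ k ∈ range n, v k) =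
    ∑ k ∈ range n, u k * ∑ j ∈ range k, v j + ∑ k ∈ range n, v k * ∑ j ∈ range k, u j
      + ∑ k ∈ range n, u k * v k := by
  induction n with
  | zero => simp
  | succ n ih => simp only [sum_range_succ]; linear_combination ih

lemma iv_refl (k : ℕ) (hk : k ≤ p) : iv p (p - k) = - iv p k := by
  simp only [iv]
  rw [Nat.cast_sub hk, CharP.cast_eq_zero, zero_sub, inv_neg]

lemma sum_range_Ico (g : ℕ → ZMod p) (h : g 0 = 0) (n : ℕ) :
    ∑ k ∈ range n, g k = ∑ k ∈ Ico 1 n, g k := by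
  cases n with
  | zero => simp
  | succ n => rw [range_eq_Ico, sum_eq_sum_Ico_succ_bot (Nat.succ_pos n), h, zero_add]

lemma H_refl (a b : ℕ) (ha : a ≠ 0) (hb : b ≠ 0) :
    ∑ k ∈ range p, iv p k ^ a * ∑ j ∈ range k, iv p j ^ b =
    (-1) ^ (a + b) * ∑ k ∈ range p, iv p k ^ b * ∑ j ∈ range k, iv p j ^ a := by
  have e : ∀ a b : ℕ, a ≠ 0 → b ≠ 0 → ∑ k ∈ range p, iv p k ^ a * ∑ j ∈ range k, iv p j ^ b
      = ∑ x ∈ (Ico 1 p).sigma (fun k => Ico 1 k), iv p x.1 ^ a * iv p x.2 ^ b := by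
    intro a b ha hb
    rw [sum_sigma, sum_range_Ico _ (by simp)]
    refine sum_congr rfl fun k _ => ?_
    rw [sum_range_Ico _ (by simp [hb]), mul_sum]
  rw [e a b ha hb, e b a hb ha, mul_sum]
  refine sum_bij' (fun x _ => ⟨p - x.2, p - x.1⟩) (fun x _ => ⟨p - x.2, p - x.1⟩) ?_ ?_ ?_ ?_ ?_
  · rintro ⟨k, j⟩ h; simp only [mem_sigma, mem_Ico] at h ⊢; omega
  · rintro ⟨k, j⟩ h; simp only [mem_sigma, mem_Ico] at h ⊢; omega
  · rintro ⟨k, j⟩ h; simp only [mem_sigma, mem_Ico] at h ⊢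
    rw [Nat.sub_sub_self (by omega), Nat.sub_sub_self (by omega)]
  · rintro ⟨k, j⟩ h; simp only [mem_sigma, mem_Ico] at h ⊢
    rw [Nat.sub_sub_self (by omega), Nat.sub_sub_self (by omega)]
  · rintro ⟨k, j⟩ h; simp only [mem_sigma, mem_Ico] at h ⊢
    rw [iv_refl _ (by omega), iv_refl _ (by omega), neg_pow, neg_pow (iv p k), pow_add]
    have h1 : ((-1 : ZMod p) ^ a) * (-1) ^ a = 1 := by rw [← mul_pow]; simp
    have h2 : ((-1 : ZMod p) ^ b) * (-1) ^ b = 1 := by rw [← mul_pow]; simp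
    linear_combination (-iv p k ^ a * iv p j ^ b) * ((-1) ^ b * (-1) ^ b * h1 + h2)

lemma H112 (h5 : 5 < p) : ∑ k ∈ range p, iv p k ^ 2 *
    ∑ j ∈ range k, iv p j * ∑ i ∈ range j, iv p i = 0 := by
  have p1 := sum_iv_pow (p := p) 1 (by omega) (by omega)
  have p2 := sum_iv_pow (p := p) 2 (by omega) (by omega)
  have p4 := sum_iv_pow (p := p) 4 (by omega) (by omega)
  have two : (2 : ZMod p) ≠ 0 := by exact_mod_cast cast_ne (p := p) (n := 2) (by omega) (by omega)
  have s22 := sum_split (p := p) (fun k => iv p k ^ 2) (fun k => iv p k ^ 2) p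
  have s13 := sum_split (p := p) (fun k => iv p k ^ 1) (fun k => iv p k ^ 3) p
  simp only [← pow_add] at s22 s13
  norm_num only at s22 s13
  rw [p2, p4] at s22
  rw [p1, p4, H_refl 1 3 (by omega) (by omega)] at s13
  have z22 : ∑ k ∈ range p, iv p k ^ 2 * ∑ j ∈ range k, iv p j ^ 2 = 0 := by
    apply (mul_eq_zero.1 (_ : (2 : ZMod p) * _ = 0)).resolve_left two
    linear_combination -s22
  have z31 : ∑ k ∈ range p, iv p k ^ 3 * ∑ j ∈ range k, iv p j ^ 1 = 0 := by
    apply (mul_eq_zero.1 (_ : (2 : ZMod p) * _ = 0)).resolve_left two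
    linear_combination -s13
  have z13 := H_refl (p := p) 1 3 (by omega) (by omega)
  rw [z31, mul_zero] at z13
  have d := duality (p := p)
  have eR : ∑ k ∈ range p, iv p k * ∑ j ∈ range (k + 1), iv p j ^ 3 =
      ∑ k ∈ range p, iv p k ^ 1 * ∑ j ∈ range k, iv p j ^ 3 + ∑ k ∈ range p, iv p k ^ 4 := by
    rw [← sum_add_distrib]; refine sum_congr rfl fun k _ => ?_
    rw [sum_range_succ]; ring
  have eL : ∑ k ∈ range p, (∑ j ∈ range (k + 1), (∑ i ∈ range (j + 1), iv p i) * iv p j) * iv p k * iv p k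
      = ∑ k ∈ range p, iv p k ^ 2 * ∑ j ∈ range k, iv p j * ∑ i ∈ range j, iv p i
      + ∑ k ∈ range p, iv p k ^ 2 * ∑ j ∈ range k, iv p j ^ 2
      + ∑ k ∈ range p, iv p k ^ 3 * ∑ j ∈ range k, iv p j ^ 1 + ∑ k ∈ range p, iv p k ^ 4 := by
    rw [← sum_add_distrib, ← sum_add_distrib, ← sum_add_distrib]
    refine sum_congr rfl fun k _ => ?_
    have : ∀ j, (∑ i ∈ range (j + 1), iv p i) * iv p j = iv p j * ∑ i ∈ range j, iv p i + iv p j ^ 2 := by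
      intro j; rw [sum_range_succ]; ring
    simp only [this, pow_one]
    rw [sum_range_succ, sum_add_distrib]; ring
  rw [eR, eL, z22, z31, z13, p4] at d
  simpa using d

lemma W_mul_coeff (g : (ZMod p)[X]) (n : ℕ) (hn : n < p) :
    (W p * g).coeff n = ∑ j ∈ range n, g.coeff j := by
  rw [mul_comm, coeff_mul, Nat.sum_antidiagonal_eq_sum_range_succ (fun i j => g.coeff i * (W p).coeff j),
    sum_range_succ]
  simp only [W_coeff, Nat.sub_self]
  norm_num
  refine sum_congr rfl fun j hj => ?_
  rw [mem_range] at hj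
  rw [if_pos (by omega)]

lemma f1_coeff0 : (f1 p).coeff 0 = 0 := by
  rw [f1_coeff]; simp

lemma f1_pow_coeff (k n : ℕ) (hn : n < p) :
    (f1 p ^ (k + 1)).coeff n = (k + 1 : ℕ) * iv p n * ∑ j ∈ range n, (f1 p ^ k).coeff j := by
  rcases Nat.eq_zero_or_pos n with rfl | h
  · simp [coeff_zero_eq_eval_zero, eval_pow]
    rw [← coeff_zero_eq_eval_zero, f1_coeff0]
  have h3 : C ((k + 1 : ℕ) : ZMod p) * (W p * f1 p ^ k) = X * derivative (f1 p ^ (k + 1)) := by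
    rw [derivative_pow, ← theta_f1]; simp; ring
  have := congrArg (fun q => coeff q n) h3
  simp only [coeff_theta, coeff_C_mul, W_mul_coeff _ n hn] at this
  have hn0 := cast_ne h hn
  simp only [iv]
  field_simp
  linear_combination -this

lemma f1_4_coeff (h5 : 5 < p) : (f1 p ^ 4).coeff p = 0 := by
  have e : (f1 p ^ 4).coeff p = ∑ k ∈ range p, - ((f1 p ^ 3).coeff k * iv p k) := by
    rw [pow_succ, coeff_mul, Nat.sum_antidiagonal_eq_sum_range_succ
      (fun i j => (f1 p ^ 3).coeff i * (f1 p).coeff j), sum_range_succ, Nat.sub_self, f1_coeff0,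
      mul_zero, add_zero]
    refine sum_congr rfl fun k hk => ?_
    rw [mem_range] at hk
    rw [f1_coeff]
    rcases Nat.eq_zero_or_pos k with rfl | h
    · simp
    · rw [if_pos (by omega)]
      have := iv_refl (p := p) k hk.le
      simp only [iv] at this ⊢
      rw [this]; ring
  have h1 : ∀ n < p, (f1 p).coeff n = iv p n := by
    intro n hn; rw [f1_coeff, if_pos hn]
  have h2 : ∀ n < p, (f1 p ^ 2).coeff n = 2 * (iv p n * ∑ j ∈ range n, iv p j) := by
    intro n hn
    rw [f1_pow_coeff 1 n hn, pow_one, sum_congr rfl fun j hj => h1 j (by rw [mem_range] at hj; omega)]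
    push_cast; ring
  have h3 : ∀ n < p, (f1 p ^ 3).coeff n = 6 * (iv p n * ∑ j ∈ range n, iv p j * ∑ i ∈ range j, iv p i) := by
    intro n hn
    rw [f1_pow_coeff 2 n hn, sum_congr rfl fun j hj => h2 j (by rw [mem_range] at hj; omega), ← mul_sum]
    push_cast; ring
  rw [e]
  have : ∀ k ∈ range p, - ((f1 p ^ 3).coeff k * iv p k) =
      -6 * (iv p k ^ 2 * ∑ j ∈ range k, iv p j * ∑ i ∈ range j, iv p i) := by
    intro k hk
    rw [h3 k (mem_range.1 hk)]; ring
  rw [sum_congr rfl this, ← mul_sum, H112 h5, mul_zero]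

lemma f1_reflect : reflect p (f1 p) = - f1 p := by
  ext n
  rw [coeff_reflect, coeff_neg]
  rcases le_or_gt n p with h | h
  · rw [revAt_le h, f1_coeff, f1_coeff]
    rcases Nat.eq_zero_or_pos n with rfl | h0
    · simp
    · have hp : 0 < p := (Fact.out : p.Prime).pos
      rw [if_pos (by omega)]
      have := iv_refl (p := p) n h
      simp only [iv] at this
      rw [this]
      rcases h.lt_or_eq with h' | h'
      · rw [if_pos h']
      · rw [if_neg (by omega)]; simp [h']
  · rw [revAt_eq_self_of_lt h, f1_coeff, if_neg (by omega), neg_zero]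

lemma f1_4_symm : (f1 p ^ 4).coeff (3 * p) = (f1 p ^ 4).coeff p := by
  have d1 : (f1 p).natDegree ≤ p := f1_natDegree.trans (by omega)
  have d2 : (f1 p * f1 p).natDegree ≤ p + p := natDegree_mul_le.trans (by omega)
  have h : reflect (p + p + (p + p)) (f1 p ^ 4) = f1 p ^ 4 := by
    rw [show f1 p ^ 4 = (f1 p * f1 p) * (f1 p * f1 p) by ring, reflect_mul _ _ d2 d2,
      reflect_mul _ _ d1 d1, f1_reflect]; ring
  conv_lhs => rw [← h]
  rw [coeff_reflect, revAt_le (by omega)]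
  congr 1; omega

lemma f1_eval1 (h5 : 5 < p) : eval 1 (f1 p) = 0 := by
  have p1 := sum_iv_pow (p := p) 1 (by omega) (by omega)
  rw [sum_range_Ico _ (by simp)] at p1
  simpa [f1, eval_finsetSum] using p1

lemma f1_pow_coeff_big (k n : ℕ) (h : k * (p - 1) < n) : (f1 p ^ k).coeff n = 0 := by
  apply coeff_eq_zero_of_natDegree_lt
  refine lt_of_le_of_lt (natDegree_pow_le.trans ?_) h
  exact Nat.mul_le_mul_left _ f1_natDegree

lemma f1_pow_coeff0 (k : ℕ) (hk : k ≠ 0) : (f1 p ^ k).coeff 0 = 0 := by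
  rw [coeff_zero_eq_eval_zero, eval_pow, ← coeff_zero_eq_eval_zero, f1_coeff0, zero_pow hk]

lemma contract_natDegree (k : ℕ) (hk : k ≠ 0) : (contract p (f1 p ^ k)).natDegree < k := by
  have hp : 0 < p := (Fact.out : p.Prime).pos
  have : (contract p (f1 p ^ k)).natDegree ≤ k - 1 := by
    rw [natDegree_le_iff_coeff_eq_zero]
    intro N hN
    rw [coeff_contract hp.ne']
    apply f1_pow_coeff_big
    calc k * (p - 1) < k * p := Nat.mul_lt_mul_of_pos_left (by omega) (by omega)
      _ ≤ N * p := Nat.mul_le_mul_right _ (by omega)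
  omega

lemma pi_sum (k : ℕ) (hk : k ≠ 0) (hk5 : k < 5) (h5 : 5 < p) :
    ∑ i ∈ range k, (contract p (f1 p ^ k)).coeff i = 0 := by
  have h := eval_ct_pow (p := p) k (cast_ne (by omega) (by omega)) (f1_eval1 h5) hk
  rw [eval_eq_sum_range' (contract_natDegree k hk)] at h
  simpa using h

lemma pi0 (k : ℕ) (hk : k ≠ 0) : (contract p (f1 p ^ k)).coeff 0 = 0 := by
  have hp : 0 < p := (Fact.out : p.Prime).pos
  rw [coeff_contract hp.ne', zero_mul, f1_pow_coeff0 k hk]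

lemma pi2 (h5 : 5 < p) : contract p (f1 p ^ 2) = 0 := by
  have h := pi_sum (p := p) 2 (by omega) (by omega) h5
  have h0 := pi0 (p := p) 2 (by omega)
  rw [as_sum_range' _ 2 (contract_natDegree (p := p) 2 (by omega))]
  simp only [sum_range_succ, sum_range_zero, h0, zero_add] at h ⊢
  simp [h]

lemma pi1 : contract p (f1 p) = 0 := by
  have h0 := pi0 (p := p) 1 (by omega)
  have h := as_sum_range' _ 1 (contract_natDegree (p := p) 1 (by omega))
  rw [pow_one] at h h0
  rw [h]
  simp [h0]

lemma pi3 (h5 : 5 < p) : ∃ c : ZMod p, contract p (f1 p ^ 3) = C c * (X - X ^ 2) := by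
  have h := pi_sum (p := p) 3 (by omega) (by omega) h5
  have h0 := pi0 (p := p) 3 (by omega)
  refine ⟨(contract p (f1 p ^ 3)).coeff 1, ?_⟩
  conv_lhs => rw [as_sum_range' _ 3 (contract_natDegree (p := p) 3 (by omega))]
  simp only [sum_range_succ, sum_range_zero, h0, zero_add] at h ⊢
  simp only [← C_mul_X_pow_eq_monomial, eq_neg_of_add_eq_zero_right h, C_neg, C_0]
  ring

lemma pi4 (h5 : 5 < p) : contract p (f1 p ^ 4) = 0 := by
  have hp : 0 < p := (Fact.out : p.Prime).pos
  have h := pi_sum (p := p) 4 (by omega) (by omega) h5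
  have h0 := pi0 (p := p) 4 (by omega)
  have h1 : (contract p (f1 p ^ 4)).coeff 1 = 0 := by
    rw [coeff_contract hp.ne', one_mul, f1_4_coeff h5]
  have h3 : (contract p (f1 p ^ 4)).coeff 3 = 0 := by
    rw [coeff_contract hp.ne', f1_4_symm, f1_4_coeff h5]
  rw [as_sum_range' _ 4 (contract_natDegree (p := p) 4 (by omega))]
  simp only [sum_range_succ, sum_range_zero, h0, h1, h3, zero_add, add_zero] at h ⊢
  simp [h]

lemma f1_comp (h5 : 5 < p) : (f1 p).comp (1 - X) = f1 p := by
  have hpp : p.Prime := Fact.out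
  have hder : derivative (f1 p) = ∑ i ∈ range (p - 1), X ^ i := by
    apply mul_left_cancel₀ (X_ne_zero (R := ZMod p))
    rw [theta_f1, W, mul_sum, sum_Ico_eq_sum_range]
    exact sum_congr rfl fun i _ => by ring
  have hgeom : ∀ u : (ZMod p)[X], (∑ i ∈ range (p - 1), u ^ i) * (u * (1 - u)) = u - u ^ p := by
    intro u
    have := geom_sum_mul u (p - 1)
    have h2 : u ^ p = u ^ (p - 1) * u := by rw [← pow_succ, Nat.sub_add_cancel hpp.one_le]
    rw [h2]
    linear_combination -u * this
  set d := f1 p - (f1 p).comp (1 - X) with hd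
  have hd0 : derivative d = 0 := by
    have hne : (X * (1 - X) : (ZMod p)[X]) ≠ 0 := by
      refine mul_ne_zero X_ne_zero fun h => ?_
      have := congrArg (eval 0) h
      simp at this
    apply (mul_eq_zero.1 (_ : derivative d * (X * (1 - X)) = 0)).resolve_right hne
    rw [hd, derivative_sub, derivative_comp, hder]
    have e1 := hgeom X
    have e2 := hgeom (1 - X)
    have e3 : (1 - X : (ZMod p)[X]) ^ p = 1 - X ^ p := by
      rw [sub_pow_char, one_pow]
    have e4 : (∑ i ∈ range (p - 1), (X : (ZMod p)[X]) ^ i).comp (1 - X) = ∑ i ∈ range (p - 1), (1 - X) ^ i := by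
      simp [Polynomial.sum_comp]
    rw [e4]
    rw [e3] at e2
    simp only [derivative_sub, derivative_one, derivative_X]
    linear_combination e1 + e2
  have hdeg : d.natDegree ≤ p - 1 := by
    refine (natDegree_sub_le _ _).trans (max_le f1_natDegree ?_)
    refine natDegree_comp_le.trans ?_
    have : (1 - X : (ZMod p)[X]).natDegree ≤ 1 := by compute_degree
    calc _ ≤ (f1 p).natDegree * 1 := Nat.mul_le_mul_left _ this
      _ ≤ _ := by rw [mul_one]; exact f1_natDegree
  have : d = 0 := by
    ext n
    rcases Nat.eq_zero_or_pos n with rfl | h0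
    · rw [hd, coeff_sub, f1_coeff0, coeff_zero_eq_eval_zero, eval_comp]
      simp [f1_eval1 h5]
    · rcases lt_or_ge n p with h | h
      · have h1 := coeff_theta d n
        rw [hd0, mul_zero, coeff_zero] at h1
        simpa using (mul_eq_zero.1 h1.symm).resolve_left (cast_ne h0 h)
      · rw [coeff_eq_zero_of_natDegree_lt (by omega), coeff_zero]
  exact (sub_eq_zero.1 this).symm

/-- The closed form of the fourfold polylogarithm. -/
lemma closed (h5 : 5 < p) : ∃ c : ZMod p, I p (W p * I p (W p * I p (W p * I p (W p)))) =
    C (24⁻¹ : ZMod p) * f1 p ^ 4 - C c * (X ^ p - (X ^ p) ^ 2) * f1 p := by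
  have hp : p ≠ 0 := (Fact.out : p.Prime).ne_zero
  have two : (2 : ZMod p) ≠ 0 := by exact_mod_cast cast_ne (p := p) (n := 2) (by omega) (by omega)
  have three : (3 : ZMod p) ≠ 0 := by exact_mod_cast cast_ne (p := p) (n := 3) (by omega) (by omega)
  have four : (4 : ZMod p) ≠ 0 := by exact_mod_cast cast_ne (p := p) (n := 4) (by omega) (by omega)
  have i2 : C (2⁻¹ : ZMod p) * 2 = 1 := by
    rw [show (2 : (ZMod p)[X]) = C 2 from rfl, ← C_mul, inv_mul_cancel₀ two, C_1]
  have i6 : C (6⁻¹ : ZMod p) * 3 = C (2⁻¹ : ZMod p) := by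
    rw [show (3 : (ZMod p)[X]) = C 3 from rfl, ← C_mul]
    congr 1; rw [show (6 : ZMod p) = 2 * 3 by norm_num]; field_simp
  have i24 : C (24⁻¹ : ZMod p) * 4 = C (6⁻¹ : ZMod p) := by
    rw [show (4 : (ZMod p)[X]) = C 4 from rfl, ← C_mul]
    congr 1; rw [show (24 : ZMod p) = 2 * 3 * 4 by norm_num, show (6 : ZMod p) = 2 * 3 by norm_num]; field_simp
  obtain ⟨c, hc⟩ := pi3 (p := p) h5
  refine ⟨6⁻¹ * c, ?_⟩
  have th := theta_f1 (p := p)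
  have s2 : I p (W p * f1 p) = C (2⁻¹ : ZMod p) * f1 p ^ 2 := by
    rw [I_theta (C (2⁻¹ : ZMod p) * f1 p ^ 2), contract_smul', pi2 h5]
    · simp
    · rw [derivative_C_mul, derivative_pow, ← th]
      simp
      have cc : (C (2 : ZMod p) : (ZMod p)[X]) = 2 := rfl
      try rw [cc]
      linear_combination (X * derivative (f1 p) * f1 p) * i2
  have s3 : I p (W p * (C (2⁻¹ : ZMod p) * f1 p ^ 2)) =
      C (6⁻¹ : ZMod p) * f1 p ^ 3 - C (6⁻¹ * c) * (X ^ p - (X ^ p) ^ 2) := by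
    rw [I_theta (C (6⁻¹ : ZMod p) * f1 p ^ 3), contract_smul', hc]
    · simp [mul_assoc]
    · rw [derivative_C_mul, derivative_pow, ← th]
      simp
      have cc : (C (3 : ZMod p) : (ZMod p)[X]) = 3 := rfl
      try rw [cc]
      linear_combination (X * derivative (f1 p) * f1 p ^ 2) * i6
  have hT : derivative (C (6⁻¹ * c) * (X ^ p - (X ^ p) ^ 2) : (ZMod p)[X]) = 0 := by
    rw [derivative_C_mul, derivative_sub, derivative_pow (X ^ p), derivative_X_pow]
    simp
  rw [I_W, s2, s3, I_theta (C (24⁻¹ : ZMod p) * f1 p ^ 4 - C (6⁻¹ * c) * (X ^ p - (X ^ p) ^ 2) * f1 p)]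
  · have e : contract p (C (24⁻¹ : ZMod p) * f1 p ^ 4 - C (6⁻¹ * c) * (X ^ p - (X ^ p) ^ 2) * f1 p) = 0 := by
      have e1 : contract p (C (24⁻¹ : ZMod p) * f1 p ^ 4) = 0 := by rw [contract_smul', pi4 h5, mul_zero]
      have e2 : contract p (f1 p * expand (ZMod p) p (C (6⁻¹ * c) * (X - X ^ 2))) = 0 := by
        rw [contract_mul_expand hp, pi1, zero_mul]
      have e3 : C (6⁻¹ * c) * (X ^ p - (X ^ p) ^ 2) * f1 p =
          f1 p * expand (ZMod p) p (C (6⁻¹ * c) * (X - X ^ 2)) := by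
        simp only [map_mul, map_sub, map_pow, expand_C, expand_X]; ring
      rw [e3]
      change ct p (_ - _) = 0
      rw [map_sub]
      change contract p _ - contract p _ = 0
      rw [e1, e2, sub_zero]
    rw [e, map_zero, sub_zero]
  · rw [derivative_sub, derivative_mul (f := C (6⁻¹ * c) * _), hT, derivative_C_mul, derivative_pow, ← th]
    simp
    have cc : (C (4 : ZMod p) : (ZMod p)[X]) = 4 := rfl
    try rw [cc]
    linear_combination (X * derivative (f1 p) * f1 p ^ 3) * i24

lemma term_eq (u : (ZMod p)[X]) (a b c d : ℕ) :
    (if ¬ p ∣ a ∧ ¬ p ∣ b ∧ ¬ p ∣ c ∧ ¬ p ∣ d then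
      C ((a : ZMod p)⁻¹ * (b : ZMod p)⁻¹ * (c : ZMod p)⁻¹ * (d : ZMod p)⁻¹) * u ^ d else 0) =
    C ((a : ZMod p)⁻¹ * (b : ZMod p)⁻¹ * (c : ZMod p)⁻¹ * (d : ZMod p)⁻¹) * u ^ d := by
  split_ifs with h
  · rfl
  · simp only [← ZMod.natCast_eq_zero_iff] at h
    have : (a : ZMod p) = 0 ∨ (b : ZMod p) = 0 ∨ (c : ZMod p) = 0 ∨ (d : ZMod p) = 0 := by tauto
    rcases this with h | h | h | h <;> simp [h]

lemma OY_eq (u : (ZMod p)[X]) : OY1111 p u =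
    (I p (W p * I p (W p * I p (W p * I p (W p))))).comp u := by
  have key : I p (W p * I p (W p * I p (W p * I p (W p)))) =
      ∑ l1 ∈ Ico 1 p, ∑ l2 ∈ Ico 1 p, ∑ l3 ∈ Ico 1 p, ∑ l4 ∈ Ico 1 p,
      C ((l1 : ZMod p)⁻¹ * ((l1 + l2 : ℕ) : ZMod p)⁻¹ * ((l1 + l2 + l3 : ℕ) : ZMod p)⁻¹
          * ((l1 + l2 + l3 + l4 : ℕ) : ZMod p)⁻¹) * X ^ (l1 + l2 + l3 + l4) := by
    rw [I_W, f1]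
    simp only [mul_sum, map_sum, W_mul_mon, I_mon]
  rw [key, OY1111]
  simp only [term_eq, Polynomial.sum_comp, mul_comp, C_comp, pow_comp, X_comp]

end OYaux

theorem OY1111_functional_equation (p : ℕ) (hp : p.Prime) (h5 : 5 < p) :
    OY1111 p X = OY1111 p (1 - X) := by
  have : Fact p.Prime := ⟨hp⟩
  obtain ⟨c, hc⟩ := OYaux.closed (p := p) h5
  rw [OYaux.OY_eq, OYaux.OY_eq, hc, comp_X]
  have e3 : (1 - X : (ZMod p)[X]) ^ p = 1 - X ^ p := by
    rw [sub_pow_char, one_pow]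
  simp only [sub_comp, mul_comp, C_comp, pow_comp, X_comp, OYaux.f1_comp h5, e3]
  ring
end

section
/- (Main theorem, fixed prime version) For every positive integer n there is a bound P(n) such that for all primes p > P(n), in (ZMod p)[t]: £^{OY}_{(1)^n}(t) = (1/n!) £_1(t)^n + (1/n!) \sum_{k=1}^n (k-1)! (f_k(t) + g_k(t)) £_1(t)^{n-k}, where f_k(t) := \sum_{j=0}^{k-2} (\sum_{i=1}^{k-j-1} Z^{(i)}((1)^{k-j-2},2) t^{ip}) £^{OY}_{(1)^j}(t) and g_k(t) := \sum_{j=0}^{k-2} (\sum_{i=1}^{k-j-2} Z^{(i)}((1)^{k-j-2}) t^{ip}) £^{OY}_{(2,(1)^j)}(t), with empty sums equal to 0. -/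
open Polynomial Finset

/-- The finite multiple polylogarithm of Ono–Yamamoto type £^OY_k(t). -/
noncomputable def OY (p r : ℕ) (k : Fin r → ℕ) : Polynomial (ZMod p) :=
  ∑ l ∈ Fintype.piFinset (fun _ : Fin r => Finset.Ico 1 p),
    if ∀ j : Fin r, ¬ p ∣ ∑ i ∈ Finset.Iic j, l i then
      C (∏ j : Fin r, (((∑ i ∈ Finset.Iic j, l i : ℕ) : ZMod p)⁻¹) ^ k j) * X ^ (∑ i, l i)
    else 0

/-- The variant `Z^(i)(k)` of finite multiple zeta values. -/
noncomputable def Zi (p r : ℕ) (k : Fin r → ℕ) (i : ℕ) : ZMod p :=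
  ∑ l ∈ Fintype.piFinset (fun _ : Fin r => Finset.Ico 1 p),
    if (i - 1) * p < (∑ j, l j) ∧ (∑ j, l j) < i * p
        ∧ (∀ j : Fin r, ¬ p ∣ ∑ i' ∈ Finset.Iic j, l i') then
      ∏ j : Fin r, (((∑ i' ∈ Finset.Iic j, l i' : ℕ) : ZMod p)⁻¹) ^ k j
    else 0

/-- fₖ(t) = ∑_{j=0}^{k-2} (∑_{i=1}^{k-j-1} Z^(i)((1)^{k-j-2},2) t^{ip}) £^OY_{(1)^j}(t). -/
noncomputable def fpoly (p k : ℕ) : Polynomial (ZMod p) :=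
  ∑ j ∈ Finset.range (k - 1),
    (∑ i ∈ Finset.Icc 1 (k - j - 1),
        C (Zi p (k - j - 1) (fun j' => if (j' : ℕ) = k - j - 2 then 2 else 1) i) * X ^ (i * p))
      * OY p j (fun _ => 1)

/-- gₖ(t) = ∑_{j=0}^{k-2} (∑_{i=1}^{k-j-2} Z^(i)((1)^{k-j-2}) t^{ip}) £^OY_{(2,(1)^j)}(t). -/
noncomputable def gpoly (p k : ℕ) : Polynomial (ZMod p) :=
  ∑ j ∈ Finset.range (k - 1),
    (∑ i ∈ Finset.Icc 1 (k - j - 2), C (Zi p (k - j - 2) (fun _ => 1) i) * X ^ (i * p))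
      * OY p (j + 1) (fun j' => if (j' : ℕ) = 0 then 2 else 1)

/-- Sums over tuples of length `r+1` split off the last entry. -/
lemma sum_snoc_aux {M : Type*} [AddCommMonoid M] (r : ℕ) (s : Finset ℕ) (f : (Fin (r+1) → ℕ) → M) :
    ∑ l ∈ Fintype.piFinset (fun _ : Fin (r+1) => s), f l
      = ∑ l ∈ Fintype.piFinset (fun _ : Fin r => s), ∑ a ∈ s,
          f (Fin.snoc (α := fun _ => ℕ) l a) := by
  rw [← Finset.sum_product']
  refine Finset.sum_nbij' (fun l => (Fin.init l, l (Fin.last r)))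
    (fun x => Fin.snoc (α := fun _ => ℕ) x.1 x.2) ?_ ?_ ?_ ?_ ?_
  · intro l hl
    simp only [Fintype.mem_piFinset, Finset.mem_product] at hl ⊢
    exact ⟨fun j => hl _, hl _⟩
  · rintro ⟨l, a⟩ hl
    simp only [Fintype.mem_piFinset, Finset.mem_product] at hl ⊢
    intro j
    refine Fin.lastCases ?_ (fun i => ?_) j
    · simpa using hl.2
    · simpa using hl.1 i
  · intro l _
    simp
  · rintro ⟨l, a⟩ _
    simp
  · intro l _
    simp

lemma snoc_sum_castSucc (r : ℕ) (l : Fin r → ℕ) (a : ℕ) (j : Fin r) :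
    ∑ i ∈ Finset.Iic j.castSucc, (Fin.snoc (α := fun _ => ℕ) l a) i = ∑ i ∈ Finset.Iic j, l i := by
  rw [show Finset.Iic j.castSucc = (Finset.Iic j).map Fin.castSuccEmb by
    ext x
    refine Fin.lastCases ?_ (fun i => ?_) x
    · simp [Fin.ext_iff]
    · simp]
  rw [Finset.sum_map]
  simp

lemma snoc_sum_all (r : ℕ) (l : Fin r → ℕ) (a : ℕ) :
    ∑ i, (Fin.snoc (α := fun _ => ℕ) l a) i = (∑ i, l i) + a := by
  simp [Fin.sum_univ_castSucc]

lemma snoc_sum_last (r : ℕ) (l : Fin r → ℕ) (a : ℕ) :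
    ∑ i ∈ Finset.Iic (Fin.last r), (Fin.snoc (α := fun _ => ℕ) l a) i = (∑ i, l i) + a := by
  rw [← snoc_sum_all]
  congr 1
  ext x
  simp [Fin.le_last]

/-- goodness of a tuple -/
def Good (p r : ℕ) (l : Fin r → ℕ) : Prop := ∀ j : Fin r, ¬ p ∣ ∑ i ∈ Finset.Iic j, l i

/-- weight of a tuple -/
def wt (p r : ℕ) (k : Fin r → ℕ) (l : Fin r → ℕ) : ZMod p :=
  ∏ j : Fin r, (((∑ i ∈ Finset.Iic j, l i : ℕ) : ZMod p)⁻¹) ^ k j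

lemma good_snoc (p r : ℕ) (l : Fin r → ℕ) (a : ℕ) :
    Good p (r+1) (Fin.snoc (α := fun _ => ℕ) l a) ↔ Good p r l ∧ ¬ p ∣ (∑ i, l i) + a := by
  unfold Good
  rw [Fin.forall_fin_succ']
  simp only [snoc_sum_castSucc, snoc_sum_last]

lemma wt_snoc (p r : ℕ) (k : Fin (r+1) → ℕ) (l : Fin r → ℕ) (a : ℕ) :
    wt p (r+1) k (Fin.snoc (α := fun _ => ℕ) l a)
      = wt p r (fun j => k j.castSucc) l
        * ((((∑ i, l i) + a : ℕ) : ZMod p)⁻¹) ^ k (Fin.last r) := by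
  unfold wt
  rw [Fin.prod_univ_castSucc]
  simp only [snoc_sum_castSucc, snoc_sum_last]

open Classical in
lemma OY_eq (p r : ℕ) (k : Fin r → ℕ) : OY p r k =
    ∑ l ∈ Fintype.piFinset (fun _ : Fin r => Finset.Ico 1 p),
      if Good p r l then C (wt p r k l) * X ^ (∑ i, l i) else 0 := by
  unfold OY Good wt
  refine Finset.sum_congr rfl fun l _ => ?_
  congr 1

open Classical in
lemma Zi_eq (p r : ℕ) (k : Fin r → ℕ) (i : ℕ) : Zi p r k i =
    ∑ l ∈ Fintype.piFinset (fun _ : Fin r => Finset.Ico 1 p),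
      if (i - 1) * p < (∑ j, l j) ∧ (∑ j, l j) < i * p ∧ Good p r l then wt p r k l else 0 := by
  unfold Zi Good wt
  refine Finset.sum_congr rfl fun l _ => ?_
  congr 1

/-- `∑ Z^(i)(k) t^{ip}` -/
noncomputable def Zp (p r : ℕ) (k : Fin r → ℕ) : Polynomial (ZMod p) :=
  ∑ i ∈ Finset.Icc 1 r, C (Zi p r k i) * X ^ (i * p)

/-- `T = ∑_{0<a<p} t^a` -/
noncomputable def Tp (p : ℕ) : Polynomial (ZMod p) := ∑ a ∈ Finset.Ico 1 p, X ^ a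

lemma key_sum {M : Type*} [AddCommMonoid M] (p r S : ℕ) (hp : 0 < p)
    (h : (¬ p ∣ S ∧ S < r * p) ∨ (S = 0 ∧ r = 0)) (g : ℕ → M) :
    ∑ a ∈ Finset.Ico 1 p, (if p ∣ S + a then g (S + a) else 0)
      = ∑ i ∈ Finset.Icc 1 r, (if (i - 1) * p < S ∧ S < i * p then g (i * p) else 0) := by
  rcases h with ⟨h1, h2⟩ | ⟨rfl, rfl⟩
  · have hm : S % p ≠ 0 := fun h => h1 (Nat.dvd_of_mod_eq_zero h)
    have hlt := Nat.mod_lt S hp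
    have hdm := Nat.div_add_mod S p
    have hq : S / p < r := (Nat.div_lt_iff_lt_mul hp).2 h2
    have e : (S / p + 1) * p = S + (p - S % p) := by
      rw [add_mul, mul_comm (S/p) p, one_mul]; omega
    rw [Finset.sum_eq_single (p - S % p), Finset.sum_eq_single (S / p + 1)]
    · have hd : p ∣ S + (p - S % p) := by rw [← e]; exact dvd_mul_left _ _
      have hi : (S / p + 1 - 1) * p < S ∧ S < (S / p + 1) * p := by
        constructor
        · rw [Nat.add_sub_cancel, mul_comm]; omega
        · rw [e]; omega
      rw [if_pos hd, if_pos hi, e]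
    · intro i hi hne
      rw [if_neg]
      rintro ⟨h3, h4⟩
      apply hne
      simp only [Finset.mem_Icc] at hi
      have h5 : S / p < i := (Nat.div_lt_iff_lt_mul hp).2 h4
      have h6 : i - 1 ≤ S / p := (Nat.le_div_iff_mul_le hp).2 h3.le
      omega
    · intro h; exact absurd (Finset.mem_Icc.2 ⟨Nat.succ_pos _, hq⟩) h
    · intro a ha hne
      rw [if_neg]
      rintro hd
      apply hne
      simp only [Finset.mem_Ico] at ha
      rw [Nat.dvd_iff_mod_eq_zero, Nat.add_mod, Nat.mod_eq_of_lt ha.2] at hd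
      have h7 : p ∣ S % p + a := Nat.dvd_of_mod_eq_zero hd
      obtain ⟨c, hc⟩ := h7
      have : c = 1 := by
        rcases c with _ | _ | c
        · omega
        · rfl
        · exfalso; nlinarith
      subst this
      omega
    · intro h; exfalso; apply h; simp only [Finset.mem_Ico]; omega
  · simp only [zero_add]
    rw [show Finset.Icc 1 0 = (∅ : Finset ℕ) by simp, Finset.sum_empty]
    refine Finset.sum_eq_zero fun a ha => if_neg fun hd => ?_
    simp only [Finset.mem_Ico] at ha
    have := Nat.le_of_dvd (by omega) hd
    omega

lemma good_bound (p r : ℕ) (hp : 0 < p) (l : Fin r → ℕ)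
    (hl : l ∈ Fintype.piFinset (fun _ : Fin r => Finset.Ico 1 p)) (hg : Good p r l) :
    (¬ p ∣ (∑ i, l i) ∧ (∑ i, l i) < r * p) ∨ ((∑ i, l i) = 0 ∧ r = 0) := by
  rcases r with _ | r
  · right; simp
  · left
    constructor
    · have := hg (Fin.last r)
      rwa [show Finset.Iic (Fin.last r) = Finset.univ by ext x; simp [Fin.le_last]] at this
    · simp only [Fintype.mem_piFinset, Finset.mem_Ico] at hl
      calc ∑ i, l i < ∑ _i : Fin (r+1), p :=
            Finset.sum_lt_sum_of_nonempty Finset.univ_nonempty fun i _ => (hl i).2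
        _ = (r+1) * p := by simp

open Classical in
lemma Zp_eq (p r : ℕ) (hp : 0 < p) (k : Fin r → ℕ) : Zp p r k =
    ∑ l ∈ Fintype.piFinset (fun _ : Fin r => Finset.Ico 1 p),
      ∑ a ∈ Finset.Ico 1 p, if Good p r l ∧ p ∣ (∑ i, l i) + a then
        C (wt p r k l) * X ^ ((∑ i, l i) + a) else 0 := by
  unfold Zp
  simp_rw [Zi_eq, map_sum, Finset.sum_mul]
  rw [Finset.sum_comm]
  refine Finset.sum_congr rfl fun l hl => ?_
  by_cases hg : Good p r l
  · simp only [hg, true_and, and_true]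
    rw [key_sum p r _ hp (good_bound p r hp l hl hg) (fun N => C (wt p r k l) * X ^ N)]
    refine Finset.sum_congr rfl fun i _ => ?_
    split_ifs <;> simp
  · simp [hg]

/-- The differential equation. -/
lemma theta_OY (p r : ℕ) [Fact p.Prime] (k : Fin (r+1) → ℕ) (hk : k (Fin.last r) = 1) :
    X * derivative (OY p (r+1) k)
      = Tp p * OY p r (fun j => k j.castSucc) - Zp p r (fun j => k j.castSucc) := by
  classical
  rw [Zp_eq p r (Fact.out : p.Prime).pos, OY_eq, OY_eq, sum_snoc_aux, eq_sub_iff_add_eq, Tp,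
    Finset.mul_sum, derivative_sum, Finset.mul_sum, ← Finset.sum_add_distrib]
  refine Finset.sum_congr rfl fun l hl => ?_
  rw [derivative_sum, Finset.mul_sum, ← Finset.sum_add_distrib, Finset.sum_mul]
  refine Finset.sum_congr rfl fun a ha => ?_
  by_cases hg : Good p r l
  · by_cases hd : p ∣ (∑ i, l i) + a
    · simp only [good_snoc, hg, hd, not_true_eq_false, and_false, if_false, if_true, and_self,
        derivative_zero, mul_zero, zero_add, pow_add]
      ring
    · simp only [good_snoc, hg, hd, not_false_eq_true, and_false, if_false, if_true, and_self,
        add_zero, wt_snoc, snoc_sum_all, hk, pow_one]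
      have hne : (((∑ i, l i) + a : ℕ) : ZMod p) ≠ 0 := by
        rwa [Ne, ZMod.natCast_eq_zero_iff]
      have hpos : 0 < (∑ i, l i) + a := by
        rcases Nat.eq_zero_or_pos ((∑ i, l i) + a) with h | h
        · rw [h] at hd; exact absurd (dvd_zero p) hd
        · exact h
      rw [derivative_C_mul_X_pow, mul_assoc, inv_mul_cancel₀ hne, mul_one, mul_left_comm,
        ← pow_succ', Nat.sub_add_cancel hpos, pow_add]
      ring
  · simp [good_snoc, hg]

/-- no coefficients at multiples of `p` -/
def NP (p : ℕ) (P : Polynomial (ZMod p)) : Prop := ∀ N, p ∣ N → P.coeff N = 0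

lemma NP.add {p : ℕ} {P Q : Polynomial (ZMod p)} (h : NP p P) (h' : NP p Q) : NP p (P + Q) := by
  intro N hN; simp [h N hN, h' N hN]

lemma NP.sub {p : ℕ} {P Q : Polynomial (ZMod p)} (h : NP p P) (h' : NP p Q) : NP p (P - Q) := by
  intro N hN; simp [h N hN, h' N hN]

lemma NP.sum {p : ℕ} {ι : Type*} (s : Finset ι) (f : ι → Polynomial (ZMod p))
    (h : ∀ i ∈ s, NP p (f i)) : NP p (∑ i ∈ s, f i) := by
  intro N hN
  rw [finsetSum_coeff]
  exact Finset.sum_eq_zero fun i hi => h i hi N hN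

lemma NP.C_mul {p : ℕ} {P : Polynomial (ZMod p)} (h : NP p P) (c : ZMod p) : NP p (C c * P) := by
  intro N hN; simp [h N hN]

lemma NP.Zp_mul {p r : ℕ} (k : Fin r → ℕ) {P : Polynomial (ZMod p)} (h : NP p P) :
    NP p (Zp p r k * P) := by
  unfold Zp
  rw [Finset.sum_mul]
  refine NP.sum _ _ fun i _ => ?_
  rw [mul_assoc]
  refine NP.C_mul ?_ _
  intro N hN
  rw [mul_comm, coeff_mul_X_pow']
  split_ifs
  · exact h _ (Nat.dvd_sub hN (dvd_mul_left _ _))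
  · rfl

lemma NP.monomial {p : ℕ} (c : ZMod p) (S : ℕ) (h : ¬ p ∣ S) : NP p (C c * X ^ S) := by
  intro N hN
  rw [coeff_C_mul, coeff_X_pow, if_neg, mul_zero]
  rintro rfl
  exact h hN

lemma NP.zero {p : ℕ} : NP p 0 := fun N _ => by simp

lemma NP.theta {p : ℕ} (P : Polynomial (ZMod p)) : NP p (X * derivative P) := by
  intro N hN
  rcases N with _ | N
  · simp
  · rw [coeff_X_mul, coeff_derivative]
    have : ((N + 1 : ℕ) : ZMod p) = 0 := (ZMod.natCast_eq_zero_iff _ _).2 hN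
    push_cast at this
    rw [this, mul_zero]

lemma NP.eq_zero {p : ℕ} [Fact p.Prime] {P : Polynomial (ZMod p)} (h : NP p P)
    (hd : derivative P = 0) : P = 0 := by
  ext N
  by_cases hN : p ∣ N
  · simp [h N hN]
  · rcases N with _ | N
    · exact absurd (dvd_zero p) hN
    · have h1 : (derivative P).coeff N = 0 := by rw [hd]; simp
      rw [coeff_derivative] at h1
      have h2 : ((N + 1 : ℕ) : ZMod p) ≠ 0 := by rwa [Ne, ZMod.natCast_eq_zero_iff]
      push_cast at h2
      simpa [h2] using h1

lemma Zp_deriv (p r : ℕ) (k : Fin r → ℕ) : derivative (Zp p r k) = 0 := by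
  unfold Zp
  rw [derivative_sum]
  refine Finset.sum_eq_zero fun i _ => ?_
  rw [derivative_C_mul_X_pow]
  simp

lemma NP.OY (p r : ℕ) (hp : 0 < p) (k : Fin (r+1) → ℕ) : NP p (OY p (r+1) k) := by
  classical
  rw [OY_eq]
  refine NP.sum _ _ fun l hl => ?_
  split_ifs with hg
  · rcases good_bound p _ hp l hl hg with h | h
    · exact NP.monomial _ _ h.1
    · omega
  · exact NP.zero

lemma OY_one (p k : ℕ) : OY p 1 (fun _ => k)
    = ∑ a ∈ Finset.Ico 1 p, C ((a : ZMod p)⁻¹ ^ k) * X ^ a := by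
  classical
  rw [OY_eq, sum_snoc_aux]
  simp only [good_snoc, wt_snoc, snoc_sum_all]
  simp only [Finset.univ_eq_empty, Finset.sum_empty, zero_add]
  have : Fintype.piFinset (fun _ : Fin 0 => Finset.Ico 1 p) = {Fin.elim0} := by
    ext x; simp [eq_iff_true_of_subsingleton]
  rw [this, Finset.sum_singleton]
  refine Finset.sum_congr rfl fun a ha => ?_
  rw [if_pos]
  · simp [wt]
  · refine ⟨fun j => j.elim0, fun hd => ?_⟩
    simp only [Finset.mem_Ico] at ha
    have := Nat.le_of_dvd (by omega) hd
    omega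

lemma theta_OY_two (p : ℕ) [Fact p.Prime] :
    X * derivative (OY p 1 (fun _ => 2)) = OY p 1 (fun _ => 1) := by
  rw [OY_one, OY_one, derivative_sum, Finset.mul_sum]
  refine Finset.sum_congr rfl fun a ha => ?_
  simp only [Finset.mem_Ico] at ha
  have hne : (a : ZMod p) ≠ 0 := by
    rw [Ne, ZMod.natCast_eq_zero_iff]
    intro hd
    have := Nat.le_of_dvd (by omega) hd
    omega
  rw [derivative_C_mul_X_pow, mul_left_comm, ← pow_succ', Nat.sub_add_cancel ha.1, pow_two,
    mul_assoc, inv_mul_cancel₀ hne, mul_one, pow_one]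

lemma OY_zero (p : ℕ) (k : Fin 0 → ℕ) : OY p 0 k = 1 := by
  simp [OY]

lemma theta_OY_one (p : ℕ) [Fact p.Prime] :
    X * derivative (OY p 1 (fun _ => 1)) = Tp p := by
  rw [theta_OY p 0 _ rfl, OY_zero]
  simp [Zp]

/-- the exponent vector `(1,…,1,2)` of length `m` -/
def kF (m : ℕ) : Fin m → ℕ := fun j' => if (j' : ℕ) = m - 1 then 2 else 1

/-- the exponent vector `(2,1,…,1)` of length `m` -/
def kB (m : ℕ) : Fin m → ℕ := fun j' => if (j' : ℕ) = 0 then 2 else 1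

lemma wt_kF (p m : ℕ) (l : Fin (m+1) → ℕ) :
    wt p (m+1) (kF (m+1)) l = wt p (m+1) (fun _ => 1) l * ((∑ i, l i : ℕ) : ZMod p)⁻¹ := by
  unfold wt kF
  rw [Fin.prod_univ_castSucc, Fin.prod_univ_castSucc,
    show Finset.Iic (Fin.last m) = Finset.univ by ext x; simp [Fin.le_last]]
  have : ∀ j : Fin m, ((j.castSucc : Fin (m+1)) : ℕ) ≠ m := by
    intro j; simp; omega
  simp only [Nat.add_sub_cancel, this, if_false, Fin.val_last, if_true]
  ring

lemma NP_mul_F (p m : ℕ) [Fact p.Prime] :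
    NP p (OY p 1 (fun _ => 1) * OY p (m+1) (fun _ => 1) + Zp p (m+1) (kF (m+1))) := by
  classical
  rw [Zp_eq p _ (Fact.out : p.Prime).pos, OY_one, OY_eq, Finset.mul_sum, ← Finset.sum_add_distrib]
  refine NP.sum _ _ fun l hl => ?_
  rw [Finset.sum_mul, ← Finset.sum_add_distrib]
  refine NP.sum _ _ fun a ha => ?_
  by_cases hg : Good p (m+1) l
  · by_cases hd : p ∣ (∑ i, l i) + a
    · simp only [hg, hd, and_self, if_true]
      have h0 : (((∑ i, l i) + a : ℕ) : ZMod p) = 0 := (ZMod.natCast_eq_zero_iff _ _).2 hd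
      rw [Nat.cast_add] at h0
      have h1 : (a : ZMod p) = - ((∑ i, l i : ℕ) : ZMod p) := by
        linear_combination h0
      rw [wt_kF, h1, inv_neg, pow_one]
      convert NP.zero using 1
      rw [C_neg, C_mul, pow_add]
      ring
    · simp only [hg, hd, and_false, if_true, if_false, add_zero]
      rw [mul_mul_mul_comm, ← C_mul, ← pow_add, add_comm a]
      exact NP.monomial _ _ hd
  · simp only [hg, false_and, if_false, mul_zero, add_zero]
    exact NP.zero

lemma fpoly_eq (p k : ℕ) : fpoly p k = ∑ j ∈ Finset.range (k - 1),
    Zp p (k - j - 1) (kF (k - j - 1)) * OY p j (fun _ => 1) := rfl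

lemma gpoly_eq (p k : ℕ) : gpoly p k = ∑ j ∈ Finset.range (k - 1),
    Zp p (k - j - 2) (fun _ => 1) * OY p (j + 1) (kB (j + 1)) := rfl

lemma kB_castSucc (m : ℕ) : (fun j : Fin (m+1) => kB (m+2) j.castSucc) = kB (m+1) := by
  ext j; simp [kB]

lemma kB_one : kB 1 = fun _ => 2 := by
  ext j; simp [kB]

lemma fpoly_succ (p n : ℕ) : fpoly p (n+2) = (∑ j ∈ Finset.range n,
    Zp p (n - j) (kF (n - j)) * OY p (j+1) (fun _ => 1)) + Zp p (n+1) (kF (n+1)) := by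
  rw [fpoly_eq, show n + 2 - 1 = n + 1 from rfl, Finset.sum_range_succ', OY_zero, mul_one]
  refine congrArg₂ (· + ·) ?_ rfl
  refine Finset.sum_congr rfl fun j _ => ?_
  rw [show n + 2 - (j + 1) - 1 = n - j by omega]

lemma fpoly_pred (p n : ℕ) : fpoly p (n+1) = ∑ j ∈ Finset.range n,
    Zp p (n - j) (kF (n - j)) * OY p j (fun _ => 1) := by
  rw [fpoly_eq, show n + 1 - 1 = n from rfl]
  refine Finset.sum_congr rfl fun j _ => ?_
  rw [show n + 1 - j - 1 = n - j by omega]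

lemma gpoly_succ (p n : ℕ) : gpoly p (n+2) = (∑ j ∈ Finset.range n,
    Zp p (n - 1 - j) (fun _ => 1) * OY p (j+2) (kB (j+2)))
      + Zp p n (fun _ => 1) * OY p 1 (fun _ => 2) := by
  rw [gpoly_eq, show n + 2 - 1 = n + 1 from rfl, Finset.sum_range_succ', ← kB_one]
  refine congrArg₂ (· + ·) ?_ rfl
  refine Finset.sum_congr rfl fun j _ => ?_
  rw [show n + 2 - (j + 1) - 2 = n - 1 - j by omega]

lemma gpoly_pred (p n : ℕ) : gpoly p (n+1) = ∑ j ∈ Finset.range n,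
    Zp p (n - 1 - j) (fun _ => 1) * OY p (j+1) (kB (j+1)) := by
  rw [gpoly_eq, show n + 1 - 1 = n from rfl]
  refine Finset.sum_congr rfl fun j _ => ?_
  rw [show n + 1 - j - 2 = n - 1 - j by omega]

lemma theta_f (p n : ℕ) [Fact p.Prime] : X * derivative (fpoly p (n+2)) = Tp p * fpoly p (n+1)
    - ∑ j ∈ Finset.range n, Zp p (n - j) (kF (n - j)) * Zp p j (fun _ => 1) := by
  rw [fpoly_succ, fpoly_pred, derivative_add, Zp_deriv, add_zero, derivative_sum, Finset.mul_sum,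
    Finset.mul_sum, ← Finset.sum_sub_distrib]
  refine Finset.sum_congr rfl fun j _ => ?_
  rw [derivative_mul, Zp_deriv, zero_mul, zero_add, mul_left_comm, theta_OY p j _ rfl]
  ring

lemma theta_g (p n : ℕ) [Fact p.Prime] : X * derivative (gpoly p (n+2)) = Tp p * gpoly p (n+1)
    - ∑ j ∈ Finset.range n, Zp p (n - 1 - j) (fun _ => 1) * Zp p (j+1) (kB (j+1))
    + Zp p n (fun _ => 1) * OY p 1 (fun _ => 1) := by
  rw [gpoly_succ, gpoly_pred, derivative_add, mul_add, derivative_mul, Zp_deriv, zero_mul, zero_add,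
    mul_left_comm, theta_OY_two, derivative_sum, Finset.mul_sum,
    Finset.mul_sum, ← Finset.sum_sub_distrib]
  congr 1
  refine Finset.sum_congr rfl fun j _ => ?_
  rw [derivative_mul, Zp_deriv, zero_mul, zero_add, mul_left_comm,
    theta_OY p (j+1) _ (by simp [kB]), kB_castSucc]
  ring

lemma recursion (p n : ℕ) [Fact p.Prime] :
    OY p 1 (fun _ => 1) * OY p n (fun _ => 1) - C ((n : ZMod p) + 1) * OY p (n+1) (fun _ => 1)
      + fpoly p (n+1) + gpoly p (n+1) = 0 := by
  have hp : 0 < p := (Fact.out : p.Prime).pos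
  induction n with
  | zero => simp [OY_zero, fpoly, gpoly]
  | succ n ih =>
    set A := OY p 1 (fun _ => 1) * OY p (n+1) (fun _ => 1)
      - C (((n+1 : ℕ) : ZMod p) + 1) * OY p (n+1+1) (fun _ => 1)
      + fpoly p (n+2) + gpoly p (n+2) with hA
    set R := C (((n+1 : ℕ) : ZMod p) + 1) * Zp p (n+1) (fun _ => 1)
      - ∑ j ∈ Finset.range n, Zp p (n - j) (kF (n - j)) * Zp p j (fun _ => 1)
      - ∑ j ∈ Finset.range n, Zp p (n - 1 - j) (fun _ => 1) * Zp p (j+1) (kB (j+1)) with hR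
    have hth : X * derivative A = R := by
      have e1 := theta_OY_one p
      have e2 := theta_OY p n (fun _ => 1) rfl
      have e3 := theta_OY p (n+1) (fun _ => 1) rfl
      have e4 := theta_f p n
      have e5 := theta_g p n
      rw [hA, hR]
      simp only [derivative_add, derivative_sub, derivative_mul, derivative_C, zero_mul, zero_add]
      have hc : C (((n+1 : ℕ) : ZMod p) + 1) = C ((n : ZMod p) + 1) + 1 := by
        rw [← C_1, ← C_add]; push_cast; rfl
      rw [hc]
      linear_combination OY p (n+1) (fun _ => 1) * e1 + OY p 1 (fun _ => 1) * e2
        - (C ((n : ZMod p) + 1) + 1) * e3 + e4 + e5 + Tp p * ih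
    have hR0 : R = 0 := by
      refine NP.eq_zero (hth ▸ NP.theta A) ?_
      simp [hR, Zp_deriv]
    have hA' : derivative A = 0 := by
      rw [hR0] at hth
      exact (mul_eq_zero.1 hth).resolve_left X_ne_zero
    refine NP.eq_zero (P := A) ?_ hA'
    have h1 := NP_mul_F p n
    have h2 : NP p (∑ j ∈ Finset.range n,
        Zp p (n - j) (kF (n - j)) * OY p (j+1) (fun _ => 1)) :=
      NP.sum _ _ fun j _ => NP.Zp_mul _ (NP.OY p _ hp _)
    have h3 : NP p (gpoly p (n+2)) := by
      rw [gpoly_eq]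
      exact NP.sum _ _ fun j _ => NP.Zp_mul _ (NP.OY p _ hp _)
    have h4 : NP p (C (((n+1 : ℕ) : ZMod p) + 1) * OY p (n+1+1) (fun _ => 1)) :=
      NP.C_mul (NP.OY p _ hp _) _
    have := ((h1.sub h4).add h2).add h3
    convert this using 1
    rw [hA, fpoly_succ]
    ring

lemma unnormalized (p n : ℕ) [Fact p.Prime] :
    C ((n.factorial : ZMod p)) * OY p n (fun _ => 1)
      = (OY p 1 (fun _ => 1)) ^ n + ∑ k ∈ Finset.Icc 1 n,
              C (((k - 1).factorial : ZMod p)) * (fpoly p k + gpoly p k)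
                * (OY p 1 (fun _ => 1)) ^ (n - k) := by
  induction n with
  | zero => simp [OY_zero]
  | succ n ih =>
    have hs : ∑ k ∈ Finset.Icc 1 n, C (((k - 1).factorial : ZMod p)) * (fpoly p k + gpoly p k)
          * (OY p 1 (fun _ => 1)) ^ (n + 1 - k)
        = OY p 1 (fun _ => 1) * ∑ k ∈ Finset.Icc 1 n,
          C (((k - 1).factorial : ZMod p)) * (fpoly p k + gpoly p k)
          * (OY p 1 (fun _ => 1)) ^ (n - k) := by
      rw [Finset.mul_sum]
      refine Finset.sum_congr rfl fun k hk => ?_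
      simp only [Finset.mem_Icc] at hk
      rw [show n + 1 - k = (n - k) + 1 by omega, pow_succ]
      ring
    rw [Finset.sum_Icc_succ_top (by omega), hs, Nat.factorial_succ, Nat.sub_self, pow_zero,
      Nat.add_sub_cancel, Nat.cast_mul, C_mul]
    have hr := recursion p n
    push_cast at hr ⊢
    linear_combination OY p 1 (fun _ => 1) * ih - C (n.factorial : ZMod p) * hr

theorem main_theorem_fixed_prime (n : ℕ) (hn : 1 ≤ n) :
    ∃ P : ℕ, ∀ p : ℕ, p.Prime → P < p →
      OY p n (fun _ => 1)
        = C ((n.factorial : ZMod p)⁻¹) * (OY p 1 (fun _ => 1)) ^ n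
          + C ((n.factorial : ZMod p)⁻¹) *
            ∑ k ∈ Finset.Icc 1 n,
              C (((k - 1).factorial : ZMod p)) * (fpoly p k + gpoly p k)
                * (OY p 1 (fun _ => 1)) ^ (n - k) := by
  refine ⟨n, fun p hp hlt => ?_⟩
  haveI : Fact p.Prime := ⟨hp⟩
  have hne : ((n.factorial : ℕ) : ZMod p) ≠ 0 := by
    rw [Ne, ZMod.natCast_eq_zero_iff, hp.dvd_factorial]
    omega
  rw [← mul_add, ← unnormalized, ← mul_assoc, ← C_mul, inv_mul_cancel₀ hne, C_1, one_mul]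
end
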